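/- Let q_1,…,q_l be pairwise distinct primes, let d_1,…,d_l ∈ ℕ with d_1 + … + d_l = d, and for each i let (z_n^{(i)})_{n≥0} be a digital sequence in [0,1)^{d_i} over Z_{q_i} generated by d_i matrices over Z_{q_i}. Then the combined (Halton–Niederreiter) sequence z_n = (z_n^{(1)}, z_n^{(2)}, …, z_n^{(l)}) in [0,1)^d is uniformly distributed if and only if each component sequence (z_n^{(i)})_{n≥0} is uniformly distributed in [0,1)^{d_i}. -/

import Mathlib

open Real

/-- The discrepancy of the first `N` points of a sequence `z` in `[0,1)^ι`. -/
noncomputable def disc {ι : Type*} [Fintype ι] (z : ℕ → ι → ℝ) (N : ℕ) : ℝ :=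
  sSup { r : ℝ | ∃ u v : ι → ℝ,
    (∀ i, 0 ≤ u i ∧ u i ≤ v i ∧ v i ≤ 1) ∧
    r = |(Nat.card {n : ℕ // n < N ∧ ∀ i, u i ≤ z n i ∧ z n i < v i} : ℝ) / N
          - ∏ i, (v i - u i)| }

/-- The digital sequence over `ZMod q` generated by the `ℕ × ℕ` matrices `C j`. -/
noncomputable def digitalSeq {q : ℕ} (d : ℕ) (C : Fin d → ℕ → ℕ → ZMod q)
    (n : ℕ) : Fin d → ℝ :=
  fun j => ∑' k : ℕ,
    ((∑ i ∈ Finset.range (Nat.digits q n).length,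
        C j k i * ((Nat.digits q n).getD i 0 : ZMod q)).val : ℝ) / (q : ℝ) ^ (k + 1)

/-- The value at `n` of the linear functional with coefficients `c` on base-`q` digit vectors. -/
def digitSum {q : ℕ} (c : ℕ → ZMod q) (n : ℕ) : ZMod q :=
  ∑ i ∈ Finset.range (Nat.digits q n).length, c i * ((Nat.digits q n).getD i 0 : ZMod q)

lemma digitSum_rec {q : ℕ} (hq : 1 < q) (c : ℕ → ZMod q) (n : ℕ) :
    digitSum c n = c 0 * n + digitSum (fun i => c (i + 1)) (n / q) := by
  rcases Nat.eq_zero_or_pos n with rfl | hn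
  · simp [digitSum]
  · unfold digitSum
    rw [Nat.digits_def' hq hn, List.length_cons, Finset.sum_range_succ']
    simp [add_comm]

lemma digitSum_eq_sum_add {q : ℕ} (hq : 1 < q) (c : ℕ → ZMod q) (m n : ℕ) :
    digitSum c n = ∑ i ∈ Finset.range m, c i * ((n / q ^ i : ℕ) : ZMod q)
      + digitSum (fun i => c (i + m)) (n / q ^ m) := by
  induction m with
  | zero => simp
  | succ m ih =>
    rw [ih, digitSum_rec hq, Finset.sum_range_succ, Nat.div_div_eq_div_mul, ← pow_succ, add_assoc]
    simp [add_assoc, add_comm 1 m]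

lemma digitSum_zero_coeff {q : ℕ} (n : ℕ) : digitSum (fun _ => (0 : ZMod q)) n = 0 := by
  simp [digitSum]

lemma sum_mul_digitSum {q : ℕ} {ι : Type*} (s : Finset ι) (t : ι → ZMod q)
    (c : ι → ℕ → ZMod q) (n : ℕ) :
    ∑ x ∈ s, t x * digitSum (c x) n = digitSum (fun i => ∑ x ∈ s, t x * c x i) n := by
  simp only [digitSum, Finset.mul_sum, Finset.sum_mul]
  rw [Finset.sum_comm]
  simp only [mul_assoc]

lemma norm_stdAddChar {q : ℕ} [NeZero q] (x : ZMod q) : ‖ZMod.stdAddChar x‖ = 1 := by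
  rw [ZMod.stdAddChar_apply]; exact Circle.norm_coe _

/-- The contribution of the lowest `m` base-`q` digits to the character of `digitSum c`. -/
noncomputable def lowChar {q : ℕ} [NeZero q] (c : ℕ → ZMod q) (m n : ℕ) : ℂ :=
  ZMod.stdAddChar (∑ i ∈ Finset.range m, c i * ((n / q ^ i : ℕ) : ZMod q))

/-- The contribution of the base-`q` digits from position `m` on, as a function of `n / q ^ m`. -/
noncomputable def highChar {q : ℕ} [NeZero q] (c : ℕ → ZMod q) (m n : ℕ) : ℂ :=
  ZMod.stdAddChar (digitSum (fun i => c (i + m)) n)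

/-- The character of `digitSum c`. -/
noncomputable def digitChar {q : ℕ} [NeZero q] (c : ℕ → ZMod q) (n : ℕ) : ℂ :=
  ZMod.stdAddChar (digitSum c n)

section
variable {q : ℕ} [NeZero q] (c : ℕ → ZMod q)

lemma norm_lowChar (m n : ℕ) : ‖lowChar c m n‖ = 1 := norm_stdAddChar _

lemma norm_highChar (m n : ℕ) : ‖highChar c m n‖ = 1 := norm_stdAddChar _

lemma norm_digitChar (n : ℕ) : ‖digitChar c n‖ = 1 := norm_stdAddChar _

lemma digitChar_eq_low_mul_high (hq : 1 < q) (m n : ℕ) :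
    digitChar c n = lowChar c m n * highChar c m (n / q ^ m) := by
  rw [digitChar, digitSum_eq_sum_add hq c m n, AddChar.map_add_eq_mul, lowChar, highChar]

lemma lowChar_add_mul (m n a : ℕ) : lowChar c m (n + q ^ m * a) = lowChar c m n := by
  unfold lowChar
  congr 1
  refine Finset.sum_congr rfl fun i hi => ?_
  have him := Finset.mem_range.1 hi
  obtain ⟨k, rfl⟩ := Nat.exists_eq_add_of_lt him
  have : q ^ (i + k + 1) * a = q ^ i * (q * (q ^ k * a)) := by ring
  rw [this, Nat.add_mul_div_left _ _ (pow_pos (NeZero.pos q) i)]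
  simp

lemma lowChar_mod (m n : ℕ) : lowChar c m (n % q ^ m) = lowChar c m n := by
  conv_rhs => rw [← Nat.mod_add_div n (q ^ m)]
  rw [lowChar_add_mul]

lemma lowChar_congr {m a b : ℕ} (h : a % q ^ m = b % q ^ m) : lowChar c m a = lowChar c m b := by
  rw [← lowChar_mod c m a, h, lowChar_mod]

lemma lowChar_succ {m n b : ℕ} (hn : n < q ^ m) :
    lowChar c (m + 1) (n + q ^ m * b) = lowChar c m n * ZMod.stdAddChar (c m * (b : ZMod q)) := by
  have h := lowChar_add_mul c m n b
  unfold lowChar at *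
  rw [Finset.sum_range_succ, AddChar.map_add_eq_mul, h,
    Nat.add_mul_div_left _ _ (pow_pos (NeZero.pos q) m), Nat.div_eq_of_lt hn, zero_add]

lemma digitChar_eq_lowChar_of_tail (hq : 1 < q) {m : ℕ} (hc : ∀ i, m ≤ i → c i = 0) (n : ℕ) :
    digitChar c n = lowChar c m n := by
  have : (fun i => c (i + m)) = fun _ => 0 := funext fun i => hc _ (Nat.le_add_left _ _)
  rw [digitChar_eq_low_mul_high c hq m, highChar, this, digitSum_zero_coeff]
  simp
end

lemma sum_range_mul_eq {M : Type*} [AddCommMonoid M] (f : ℕ → M) (a b : ℕ) :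
    ∑ n ∈ Finset.range (a * b), f n
      = ∑ j ∈ Finset.range b, ∑ i ∈ Finset.range a, f (i + a * j) := by
  induction b with
  | zero => simp
  | succ b ih =>
    rw [Nat.mul_succ, Finset.sum_range_add, ih, Finset.sum_range_succ]
    simp [add_comm]

/-- The generating polynomial of `lowChar` factors over the digits. -/
lemma sum_lowChar_mul_pow {q : ℕ} [NeZero q] (c : ℕ → ZMod q) (m : ℕ) (z : ℂ) :
    ∑ n ∈ Finset.range (q ^ m), lowChar c m n * z ^ n
      = ∏ j ∈ Finset.range m,
          ∑ b ∈ Finset.range q, (ZMod.stdAddChar (c j) * z ^ q ^ j) ^ b := by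
  induction m with
  | zero => simp [lowChar]
  | succ m ih =>
    rw [pow_succ, sum_range_mul_eq, Finset.prod_range_succ, ← ih, Finset.mul_sum]
    refine Finset.sum_congr rfl fun b _ => ?_
    rw [Finset.sum_mul]
    refine Finset.sum_congr rfl fun n hn => ?_
    rw [lowChar_succ c (Finset.mem_range.1 hn), mul_pow, ← AddChar.map_nsmul_eq_pow, nsmul_eq_mul,
      mul_comm (b : ZMod q), pow_add, ← pow_mul]
    ring

lemma norm_sum_pow_le (q : ℕ) {x : ℂ} (hx : ‖x‖ = 1) :
    ‖∑ b ∈ Finset.range q, x ^ b‖ ≤ q := by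
  refine (norm_sum_le _ _).trans ?_
  simp [hx]

lemma eq_one_of_norm_sum_pow_eq {q : ℕ} (hq : 1 < q) {x : ℂ} (hx : ‖x‖ = 1)
    (h : (q : ℝ) ≤ ‖∑ b ∈ Finset.range q, x ^ b‖) : x = 1 := by
  obtain ⟨k, rfl⟩ := Nat.exists_eq_add_of_le hq
  have h1 : ‖∑ b ∈ Finset.range k, x ^ (1 + 1 + b)‖ ≤ k := by
    refine (norm_sum_le _ _).trans ?_
    simp [hx]
  rw [Finset.sum_range_add, Nat.cast_add] at h
  have h2 : ∑ b ∈ Finset.range (1 + 1), x ^ b = 1 + x := by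
    simp [Finset.sum_range_succ]
  rw [Nat.succ_eq_add_one, h2] at h
  have h3 := h.trans (norm_add_le _ _)
  have h4 : ‖(1 : ℂ) + x‖ = ‖(1 : ℂ)‖ + ‖x‖ := by
    refine le_antisymm (norm_add_le _ _) ?_
    rw [hx, norm_one]
    push_cast at h3
    linarith
  have h5 := sameRay_iff_norm_add.2 h4
  exact (h5.eq_of_norm_eq (by rw [hx, norm_one])).symm

lemma sum_pow_eq_zero {q : ℕ} {ω : ℂ} (hω : ω ^ q = 1) (h1 : ω ≠ 1) :
    ∑ b ∈ Finset.range q, ω ^ b = 0 := by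
  rw [geom_sum_eq h1, hω, sub_self, zero_div]

lemma stdAddChar_pow_self {q : ℕ} [NeZero q] (c : ZMod q) :
    (ZMod.stdAddChar c : ℂ) ^ q = 1 := by
  rw [← AddChar.map_nsmul_eq_pow]; simp

lemma stdAddChar_ne_one {q : ℕ} [NeZero q] {c : ZMod q} (hc : c ≠ 0) :
    (ZMod.stdAddChar c : ℂ) ≠ 1 := by
  rw [← AddChar.map_zero_eq_one (ZMod.stdAddChar (N := q))]
  exact fun h => hc (ZMod.injective_stdAddChar h)

/-- Two consecutive digit factors cannot both be close to their trivial bound when the second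
coefficient is nonzero. -/
lemma exists_two_digit_contraction {q : ℕ} [NeZero q] (hq : 1 < q) :
    ∃ ρ : ℝ, 0 ≤ ρ ∧ ρ < 1 ∧ ∀ c d : ZMod q, d ≠ 0 → ∀ z : ℂ, ‖z‖ = 1 →
      ‖∑ b ∈ Finset.range q, (ZMod.stdAddChar c * z) ^ b‖ *
        ‖∑ b ∈ Finset.range q, (ZMod.stdAddChar d * z ^ q) ^ b‖ ≤ ρ * q ^ 2 := by
  have hq0 : (0 : ℝ) < q := by exact_mod_cast NeZero.pos q
  have key : ∀ d : ZMod q, ∃ ρ : ℝ, 0 ≤ ρ ∧ ρ < 1 ∧ (d ≠ 0 → ∀ x : ℂ, ‖x‖ = 1 →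
      ‖∑ b ∈ Finset.range q, x ^ b‖ *
        ‖∑ b ∈ Finset.range q, (ZMod.stdAddChar d * x ^ q) ^ b‖ ≤ ρ * q ^ 2) := by
    intro d
    obtain ⟨x, hx, hmax⟩ := (isCompact_sphere (0 : ℂ) 1).exists_isMaxOn
      (NormedSpace.sphere_nonempty.2 zero_le_one) (f := fun x : ℂ =>
        ‖∑ b ∈ Finset.range q, x ^ b‖ *
          ‖∑ b ∈ Finset.range q, (ZMod.stdAddChar d * x ^ q) ^ b‖)
      (by fun_prop)
    have hx1 : ‖x‖ = 1 := by simpa using hx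
    by_cases hd : d = 0
    · exact ⟨0, le_rfl, one_pos, fun h => absurd hd h⟩
    set A := ‖∑ b ∈ Finset.range q, x ^ b‖
    set B := ‖∑ b ∈ Finset.range q, (ZMod.stdAddChar d * x ^ q) ^ b‖
    have hA : A ≤ q := norm_sum_pow_le q hx1
    have hB : B ≤ q := norm_sum_pow_le q (by simp [hx1])
    have hA0 : 0 ≤ A := norm_nonneg _
    have hB0 : 0 ≤ B := norm_nonneg _
    have hlt : A * B < q ^ 2 := by
      by_cases hAq : (q : ℝ) ≤ A
      · have hx2 := eq_one_of_norm_sum_pow_eq hq hx1 hAq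
        have : B = 0 := by
          simp only [B, hx2, one_pow, mul_one]
          rw [sum_pow_eq_zero (stdAddChar_pow_self d) (stdAddChar_ne_one hd), norm_zero]
        rw [this, mul_zero]; positivity
      · push Not at hAq
        calc A * B ≤ A * q := by gcongr
          _ < q * q := by gcongr
          _ = q ^ 2 := by ring
    refine ⟨A * B / q ^ 2, by positivity, (div_lt_one (by positivity)).2 hlt, fun _ y hy => ?_⟩
    rw [div_mul_cancel₀ _ (by positivity)]
    exact hmax (by simpa using hy)
  choose ρ h0 h1 h2 using key
  obtain ⟨d₀, hd₀⟩ := Finite.exists_max ρ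
  refine ⟨ρ d₀, h0 _, h1 _, fun c d hd z hz => ?_⟩
  have h := h2 d hd (ZMod.stdAddChar c * z) (by simp [hz])
  rw [mul_pow, stdAddChar_pow_self, one_mul] at h
  refine h.trans ?_
  gcongr
  exact hd₀ d

lemma norm_sum_lowChar_mul_pow_le {q : ℕ} [NeZero q] (hq : 1 < q) (c : ℕ → ZMod q)
    (hc : ∀ m, ∃ j, m ≤ j ∧ c j ≠ 0) {ε : ℝ} (hε : 0 < ε) :
    ∃ m, ∀ z : ℂ, ‖z‖ = 1 →
      ‖∑ n ∈ Finset.range (q ^ m), lowChar c m n * z ^ n‖ ≤ ε * q ^ m := by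
  obtain ⟨ρ, h0, h1, hρ⟩ := exists_two_digit_contraction hq
  have key : ∀ R : ℕ, ∃ m, ∀ z : ℂ, ‖z‖ = 1 →
      ∏ j ∈ Finset.range m,
          ‖∑ b ∈ Finset.range q, (ZMod.stdAddChar (c j) * z ^ q ^ j) ^ b‖ ≤ ρ ^ R * q ^ m := by
    intro R
    induction R with
    | zero => exact ⟨0, by simp⟩
    | succ R ih =>
      obtain ⟨m, hm⟩ := ih
      obtain ⟨j, hj, hcj⟩ := hc (m + 1)
      obtain ⟨k, rfl⟩ := Nat.exists_eq_add_of_le hj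
      refine ⟨m + k + 2, fun z hz => ?_⟩
      have e : m + 1 + k = m + k + 1 := by ring
      rw [e] at hcj
      rw [Finset.prod_range_succ, Finset.prod_range_succ, Finset.prod_range_add, mul_assoc]
      have h3 := hρ (c (m + k)) (c (m + k + 1)) hcj (z ^ q ^ (m + k)) (by simp [hz])
      rw [← pow_mul z, ← pow_succ q] at h3
      have h4 : ∏ x ∈ Finset.range k, ‖∑ b ∈ Finset.range q,
          (ZMod.stdAddChar (c (m + x)) * z ^ q ^ (m + x)) ^ b‖ ≤ (q : ℝ) ^ k := by
        refine (Finset.prod_le_prod (fun _ _ => norm_nonneg _) fun x _ =>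
          norm_sum_pow_le q (by simp [hz])).trans (by simp)
      calc _ ≤ (ρ ^ R * q ^ m * q ^ k) * (ρ * q ^ 2) := by
            gcongr
            exact hm z hz
        _ = _ := by ring
  obtain ⟨R, hR⟩ := exists_pow_lt_of_lt_one hε h1
  obtain ⟨m, hm⟩ := key R
  refine ⟨m, fun z hz => ?_⟩
  rw [sum_lowChar_mul_pow, norm_prod]
  exact (hm z hz).trans (by gcongr)

lemma parseval_range (K : ℕ) (hK : 0 < K) :
    ∃ ζ : ℂ, ‖ζ‖ = 1 ∧ ∀ a : ℕ → ℂ,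
      ∑ k ∈ Finset.range K, ‖∑ s ∈ Finset.range K, a s * (ζ ^ k) ^ s‖ ^ 2
        = K * ∑ s ∈ Finset.range K, ‖a s‖ ^ 2 := by
  have hp := Complex.isPrimitiveRoot_exp K hK.ne'
  set ζ := Complex.exp (2 * π * Complex.I / K)
  have hζ : ‖ζ‖ = 1 := hp.norm'_eq_one hK.ne'
  refine ⟨ζ, hζ, fun a => ?_⟩
  have hconj : ζ * (starRingEnd ℂ) ζ = 1 := by
    rw [Complex.mul_conj, Complex.normSq_eq_norm_sq, hζ]; simp
  have orth : ∀ s < K, ∀ t < K, ∑ k ∈ Finset.range K, (ζ ^ s * (starRingEnd ℂ) ζ ^ t) ^ k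
      = if s = t then (K : ℂ) else 0 := by
    intro s hs t ht
    split_ifs with h
    · subst h
      simp [← mul_pow, hconj]
    · apply sum_pow_eq_zero
      · rw [mul_pow, ← pow_mul, ← pow_mul, mul_comm s, mul_comm t, pow_mul, pow_mul, ← map_pow,
          hp.pow_eq_one]; simp
      · intro h1
        apply h
        refine hp.pow_inj hs ht ?_
        calc ζ ^ s = ζ ^ s * (ζ * (starRingEnd ℂ) ζ) ^ t := by rw [hconj, one_pow, mul_one]
          _ = (ζ ^ s * (starRingEnd ℂ) ζ ^ t) * ζ ^ t := by ring
          _ = ζ ^ t := by rw [h1, one_mul]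
  have hsq : ∀ w : ℂ, ((‖w‖ ^ 2 : ℝ) : ℂ) = w * (starRingEnd ℂ) w := by
    intro w; rw [Complex.mul_conj, Complex.normSq_eq_norm_sq]
  rw [← Complex.ofReal_inj]
  push_cast
  simp only [← Complex.ofReal_pow, hsq, map_sum, map_mul, map_pow, Finset.sum_mul_sum]
  rw [Finset.sum_comm, Finset.mul_sum]
  refine Finset.sum_congr rfl fun s hs => ?_
  rw [Finset.sum_comm]
  have : ∀ t ∈ Finset.range K, ∑ k ∈ Finset.range K,
      a s * (ζ ^ k) ^ s * ((starRingEnd ℂ) (a t) * ((starRingEnd ℂ) ζ ^ k) ^ t)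
      = if s = t then K * (a s * (starRingEnd ℂ) (a t)) else 0 := by
    intro t ht
    rw [← mul_boole, mul_comm (K : ℂ), mul_assoc, mul_boole,
      ← orth s (Finset.mem_range.1 hs) t (Finset.mem_range.1 ht), Finset.mul_sum]
    refine Finset.sum_congr rfl fun k _ => ?_
    rw [mul_pow, ← pow_mul, ← pow_mul, ← pow_mul, ← pow_mul, mul_comm k s, mul_comm k t]
    ring
  rw [Finset.sum_congr rfl this, Finset.sum_ite_eq, if_pos hs]

/-- Coefficients of the product of `∑ x < P, A x z ^ x` and `∑ h < P, b h z ^ (P - h)`. -/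
noncomputable def hankelCoeff (P : ℕ) (A b : ℕ → ℂ) (s : ℕ) : ℂ :=
  ∑ x ∈ Finset.range P, ∑ h ∈ Finset.range P, if x + P = s + h then A x * b h else 0

lemma sum_hankelCoeff_mul_pow (P : ℕ) (A b : ℕ → ℂ) (z : ℂ) :
    ∑ s ∈ Finset.range (2 * P), hankelCoeff P A b s * z ^ s
      = (∑ x ∈ Finset.range P, A x * z ^ x) * ∑ h ∈ Finset.range P, b h * z ^ (P - h) := by
  simp only [hankelCoeff, Finset.sum_mul]
  rw [Finset.sum_comm]
  refine Finset.sum_congr rfl fun x hx => ?_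
  rw [Finset.mul_sum, Finset.sum_comm]
  refine Finset.sum_congr rfl fun h hh => ?_
  have hx := Finset.mem_range.1 hx
  have hh := Finset.mem_range.1 hh
  have : ∀ s, (x + P = s + h) ↔ s = x + (P - h) := by intro s; omega
  simp only [this, ite_mul, zero_mul, Finset.sum_ite_eq']
  rw [if_pos (by rw [Finset.mem_range]; omega), pow_add]
  ring

lemma hankelCoeff_add {P : ℕ} (A b : ℕ → ℂ) (ν : ℕ) :
    hankelCoeff P A b (ν + P) = ∑ h ∈ Finset.range P, if ν + h < P then A (ν + h) * b h else 0 := by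
  unfold hankelCoeff
  rw [Finset.sum_comm]
  refine Finset.sum_congr rfl fun h _ => ?_
  have : ∀ x, (x + P = ν + P + h) ↔ x = ν + h := by intro x; omega
  simp only [this, Finset.sum_ite_eq', Finset.mem_range]

lemma hankelCoeff_of_lt {P : ℕ} (A b : ℕ → ℂ) {ν : ℕ} (hν : ν < P) :
    hankelCoeff P A b ν
      = ∑ h ∈ Finset.range P, if ν + h < P then 0 else A (ν + h - P) * b h := by
  unfold hankelCoeff
  rw [Finset.sum_comm]
  refine Finset.sum_congr rfl fun h hh => ?_
  have hh := Finset.mem_range.1 hh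
  split_ifs with h1
  · refine Finset.sum_eq_zero fun x _ => if_neg (by omega)
  · have : ∀ x, (x + P = ν + h) ↔ x = ν + h - P := by intro x; omega
    simp only [this, Finset.sum_ite_eq', Finset.mem_range]
    rw [if_pos (by omega)]

/-- A Hankel form is bounded by the supremum of its symbol on the unit circle. -/
lemma sum_norm_hankelCoeff_le {P : ℕ} {A b : ℕ → ℂ} (hb : ∀ h, ‖b h‖ ≤ 1) {ε : ℝ} (hε : 0 ≤ ε)
    (hA : ∀ z : ℂ, ‖z‖ = 1 → ‖∑ x ∈ Finset.range P, A x * z ^ x‖ ≤ ε * P) :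
    ∑ s ∈ Finset.range (2 * P), ‖hankelCoeff P A b s‖ ≤ 2 * ε * P ^ 2 := by
  rcases Nat.eq_zero_or_pos P with rfl | hP
  · simp
  have hP' : (0 : ℝ) < P := by exact_mod_cast hP
  obtain ⟨ζ, hζ, hpars⟩ := parseval_range (2 * P) (by omega)
  have h1 := hpars (hankelCoeff P A b)
  set b' : ℕ → ℂ := fun t => if 0 < t ∧ t ≤ P then b (P - t) else 0
  have hb' : ∀ z : ℂ, ∑ h ∈ Finset.range P, b h * z ^ (P - h)
      = ∑ t ∈ Finset.range (2 * P), b' t * z ^ t := by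
    intro z
    simp only [b', ite_mul, zero_mul]
    rw [← Finset.sum_filter]
    refine Finset.sum_nbij' (fun h => P - h) (fun t => P - t) ?_ ?_ ?_ ?_ ?_
    · intro h; simp only [Finset.mem_range, Finset.mem_filter]; omega
    · intro h; simp only [Finset.mem_range, Finset.mem_filter]; omega
    · intro h; simp only [Finset.mem_range]; omega
    · intro h; simp only [Finset.mem_range, Finset.mem_filter]; omega
    · intro h hh
      rw [Nat.sub_sub_self (Finset.mem_range.1 hh).le]
  have h2 : ∑ t ∈ Finset.range (2 * P), ‖b' t‖ ^ 2 ≤ P := by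
    calc _ ≤ ∑ t ∈ Finset.range (2 * P), if t ∈ Finset.Ioc 0 P then (1 : ℝ) else 0 := by
          refine Finset.sum_le_sum fun t _ => ?_
          simp only [b', Finset.mem_Ioc]
          split_ifs
          · exact pow_le_one₀ (norm_nonneg _) (hb _)
          · simp
      _ ≤ ∑ t ∈ Finset.Ioc 0 P, (1 : ℝ) := by
          rw [← Finset.sum_filter]
          refine Finset.sum_le_sum_of_subset_of_nonneg ?_ (by simp)
          intro t; simp
      _ = P := by simp
  have h3 : ((2 * P : ℕ) : ℝ) * ∑ s ∈ Finset.range (2 * P), ‖hankelCoeff P A b s‖ ^ 2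
      ≤ (ε * P) ^ 2 * ((2 * P : ℕ) * P) := by
    rw [← h1]
    calc _ ≤ ∑ k ∈ Finset.range (2 * P),
          (ε * P) ^ 2 * ‖∑ t ∈ Finset.range (2 * P), b' t * (ζ ^ k) ^ t‖ ^ 2 := by
          refine Finset.sum_le_sum fun k _ => ?_
          rw [sum_hankelCoeff_mul_pow, norm_mul, mul_pow, hb']
          gcongr
          exact hA _ (by simp [hζ])
      _ = (ε * P) ^ 2 * ((2 * P : ℕ) * ∑ t ∈ Finset.range (2 * P), ‖b' t‖ ^ 2) := by
          rw [← Finset.mul_sum, hpars]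
      _ ≤ _ := by gcongr
  have h4 := sq_sum_le_card_mul_sum_sq (s := Finset.range (2 * P))
    (f := fun s => ‖hankelCoeff P A b s‖)
  rw [Finset.card_range] at h4
  refine le_of_abs_le (abs_le_of_sq_le_sq ?_ (by positivity))
  refine (h4.trans h3).trans ?_
  push_cast
  nlinarith [sq_nonneg (ε * P), mul_nonneg (sq_nonneg (ε * P)) (sq_nonneg (P : ℝ))]

lemma norm_sum_shift_sub_le {F : ℕ → ℂ} (hF : ∀ n, ‖F n‖ ≤ 1) (N h : ℕ) :
    ‖∑ n ∈ Finset.range N, F n - ∑ n ∈ Finset.range N, F (n + h)‖ ≤ 2 * h := by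
  have h1 := Finset.sum_range_add F N h
  have h2 := Finset.sum_range_add F h N
  rw [add_comm h N, h1] at h2
  simp only [add_comm h] at h2
  have h3 : ∑ n ∈ Finset.range N, F n - ∑ n ∈ Finset.range N, F (n + h)
      = ∑ n ∈ Finset.range h, F n - ∑ n ∈ Finset.range h, F (N + n) := by
    linear_combination h2
  have h4 : ∀ G : ℕ → ℂ, (∀ n, ‖G n‖ ≤ 1) → ‖∑ n ∈ Finset.range h, G n‖ ≤ h := fun G hG =>
    (norm_sum_le_of_le _ fun n _ => hG n).trans (by simp)
  rw [h3]
  refine (norm_sub_le _ _).trans ?_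
  linarith [h4 F hF, h4 (fun n => F (N + n)) fun n => hF _]

lemma sum_range_le_of_periodic {u : ℕ → ℝ} (h0 : ∀ n, 0 ≤ u n) {K : ℕ} (hK : 0 < K)
    (hper : Function.Periodic u K) (N : ℕ) :
    ∑ n ∈ Finset.range N, u n ≤ (N / K + 1) * ∑ n ∈ Finset.range K, u n := by
  have hN : N ≤ K * (N / K + 1) := by
    have := Nat.lt_mul_div_succ N hK
    exact this.le
  calc _ ≤ ∑ n ∈ Finset.range (K * (N / K + 1)), u n :=
        Finset.sum_le_sum_of_subset_of_nonneg (Finset.range_mono hN) fun _ _ _ => h0 _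
    _ = ((N / K : ℕ) + 1) * ∑ n ∈ Finset.range K, u n := by
        rw [sum_range_mul_eq]
        have : ∀ j i, u (i + K * j) = u i := fun j i => by
          rw [mul_comm]; exact hper.nat_mul j i
        simp [this]
    _ ≤ _ := by
        have := Finset.sum_nonneg fun n (_ : n ∈ Finset.range K) => h0 n
        gcongr
        exact Nat.cast_div_le

/-- If the short window sums of a bounded function are dominated by periodic functions of small
mean, the function has mean value zero. -/
lemma tendsto_mean_zero_of_window {F : ℕ → ℂ} (hF : ∀ n, ‖F n‖ ≤ 1)
    (h : ∀ ε : ℝ, 0 < ε → ∃ H K : ℕ, 0 < H ∧ 0 < K ∧ ∃ u : ℕ → ℝ, (∀ n, 0 ≤ u n) ∧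
      Function.Periodic u K ∧ (∀ n, ‖∑ h ∈ Finset.range H, F (n + h)‖ ≤ H * u n) ∧
      ∑ n ∈ Finset.range K, u n ≤ ε * K) :
    Filter.Tendsto (fun N : ℕ => (∑ n ∈ Finset.range N, F n) / N) Filter.atTop (nhds 0) := by
  rw [Metric.tendsto_atTop]
  intro δ hδ
  obtain ⟨H, K, hH, hK, u, hu0, hper, hwin, hmean⟩ := h (δ / 2) (by positivity)
  have hH' : (0 : ℝ) < H := by exact_mod_cast hH
  have hK' : (0 : ℝ) < K := by exact_mod_cast hK
  obtain ⟨N₀, hN₀⟩ := exists_nat_gt ((2 * H + δ / 2 * K) / (δ / 2))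
  refine ⟨N₀ + 1, fun N hN => ?_⟩
  have hNpos : (0 : ℝ) < N := by exact_mod_cast (by omega : 0 < N)
  have hNlt : (2 * H + δ / 2 * K) < δ / 2 * N := by
    rw [div_lt_iff₀ (by positivity)] at hN₀
    have : (N₀ : ℝ) ≤ N := by exact_mod_cast (by omega : N₀ ≤ N)
    nlinarith
  have h1 : ‖(H : ℂ) * ∑ n ∈ Finset.range N, F n
      - ∑ n ∈ Finset.range N, ∑ h ∈ Finset.range H, F (n + h)‖ ≤ H * (2 * H) := by
    rw [Finset.sum_comm]
    have : (H : ℂ) * ∑ n ∈ Finset.range N, F n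
        = ∑ h ∈ Finset.range H, ∑ n ∈ Finset.range N, F n := by simp
    rw [this, ← Finset.sum_sub_distrib]
    refine (norm_sum_le_of_le (f := fun h => ∑ n ∈ Finset.range N, F n
      - ∑ n ∈ Finset.range N, F (n + h)) (n := fun _ => (2 * H : ℝ)) _ fun h hh => ?_).trans
        (by simp)
    refine (norm_sum_shift_sub_le hF N h).trans ?_
    have : (h : ℝ) ≤ H := by exact_mod_cast (Finset.mem_range.1 hh).le
    linarith
  have h2 : ‖∑ n ∈ Finset.range N, ∑ h ∈ Finset.range H, F (n + h)‖
      ≤ H * (δ / 2 * N + δ / 2 * K) := by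
    refine (norm_sum_le_of_le _ fun n _ => hwin n).trans ?_
    rw [← Finset.mul_sum]
    gcongr
    refine (sum_range_le_of_periodic hu0 hK hper N).trans ?_
    calc _ ≤ ((N : ℝ) / K + 1) * (δ / 2 * K) := by gcongr
      _ = _ := by field_simp
  have h3 : (H : ℝ) * ‖∑ n ∈ Finset.range N, F n‖
      ≤ H * (2 * H + δ / 2 * N + δ / 2 * K) := by
    have := norm_sub_norm_le ((H : ℂ) * ∑ n ∈ Finset.range N, F n)
      (∑ n ∈ Finset.range N, ∑ h ∈ Finset.range H, F (n + h))
    rw [norm_mul, Complex.norm_natCast] at this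
    linarith
  have h4 := le_of_mul_le_mul_left h3 hH'
  rw [dist_zero_right, norm_div, Complex.norm_natCast, div_lt_iff₀ hNpos]
  linarith

lemma sum_range_crt {M : Type*} [AddCommMonoid M] {P R : ℕ} (hP : 0 < P) (hR : 0 < R)
    (h : P.Coprime R) (f : ℕ → ℕ → M) :
    ∑ n ∈ Finset.range (P * R), f (n % P) (n % R)
      = ∑ a ∈ Finset.range P, ∑ b ∈ Finset.range R, f a b := by
  rw [← Finset.sum_product']
  refine Finset.sum_bij' (fun n _ => (n % P, n % R))
    (fun x _ => (Nat.chineseRemainder h x.1 x.2 : ℕ)) ?_ ?_ ?_ ?_ ?_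
  · intro n _
    simp [Nat.mod_lt _ hP, Nat.mod_lt _ hR]
  · intro x _
    exact Finset.mem_range.2 (Nat.chineseRemainder_lt_mul h _ _ hP.ne' hR.ne')
  · intro n hn
    refine Nat.ModEq.eq_of_lt_of_lt ?_ (Nat.chineseRemainder_lt_mul h _ _ hP.ne' hR.ne')
      (Finset.mem_range.1 hn)
    rw [← Nat.modEq_and_modEq_iff_modEq_mul h]
    exact ⟨(Nat.chineseRemainder h _ _).2.1.trans (Nat.mod_modEq _ _),
      (Nat.chineseRemainder h _ _).2.2.trans (Nat.mod_modEq _ _)⟩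
  · intro x hx
    obtain ⟨h1, h2⟩ := Finset.mem_product.1 hx
    ext
    · exact Eq.trans (Nat.chineseRemainder h _ _).2.1 (Nat.mod_eq_of_lt (Finset.mem_range.1 h1))
    · exact Eq.trans (Nat.chineseRemainder h _ _).2.2 (Nat.mod_eq_of_lt (Finset.mem_range.1 h2))
  · intro n _; rfl

lemma coprime_pow_prod_erase {ι : Type*} [Fintype ι] [DecidableEq ι] {q : ι → ℕ}
    (hq : ∀ i, (q i).Prime) (hdist : Function.Injective q) (i₀ : ι) (m M : ℕ) :
    (q i₀ ^ m).Coprime (∏ i ∈ Finset.univ.erase i₀, q i ^ M) := by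
  refine Nat.Coprime.prod_right fun i hi => ?_
  refine Nat.Coprime.pow _ _ ((Nat.coprime_primes (hq _) (hq _)).2 fun h => ?_)
  exact Finset.ne_of_mem_erase hi (hdist h).symm

section
variable {ι : Type*} [Fintype ι] {q : ι → ℕ} [∀ i, NeZero (q i)]

lemma tendsto_mean_digitChar_of_finite [DecidableEq ι] (hq : ∀ i, (q i).Prime)
    (hdist : Function.Injective q) (c : ∀ i, ℕ → ZMod (q i)) (i₀ : ι) (hi₀ : ∃ j, c i₀ j ≠ 0)
    (hc : ∀ i, ∃ m, ∀ j, m ≤ j → c i j = 0) :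
    Filter.Tendsto (fun N : ℕ => (∑ n ∈ Finset.range N, ∏ i, digitChar (c i) n) / N)
      Filter.atTop (nhds 0) := by
  choose m hm using hc
  obtain ⟨M, hM⟩ := Finite.exists_le m
  have hlow : ∀ i n, digitChar (c i) n = lowChar (c i) M n := fun i =>
    digitChar_eq_lowChar_of_tail _ (hq i).one_lt fun j hj => hm i j ((hM i).trans hj)
  simp only [hlow]
  set P := q i₀ ^ M
  set R := ∏ i ∈ Finset.univ.erase i₀, q i ^ M
  have hP : 0 < P := pow_pos (hq _).pos _
  have hR : 0 < R := Finset.prod_pos fun i _ => pow_pos (hq _).pos _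
  have hsplit : ∀ n, ∏ i, lowChar (c i) M n
      = lowChar (c i₀) M (n % P) * ∏ i ∈ Finset.univ.erase i₀, lowChar (c i) M (n % R) := by
    intro n
    rw [← Finset.mul_prod_erase _ _ (Finset.mem_univ i₀), lowChar_mod]
    congr 1
    refine Finset.prod_congr rfl fun i hi => lowChar_congr _ ?_
    rw [Nat.mod_mod_of_dvd _ (Finset.dvd_prod_of_mem _ hi)]
  have hper : Function.Periodic (fun n => ∏ i, lowChar (c i) M n) (P * R) := by
    intro n
    simp only [hsplit]
    rw [Nat.add_mul_mod_self_left, Nat.add_mul_mod_self_right]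
  have hzero : ∑ n ∈ Finset.range (P * R), ∏ i, lowChar (c i) M n = 0 := by
    simp only [hsplit]
    rw [sum_range_crt hP hR (coprime_pow_prod_erase hq hdist i₀ M M)
      (fun a b => lowChar (c i₀) M a * ∏ i ∈ Finset.univ.erase i₀, lowChar (c i) M b)]
    simp only [← Finset.mul_sum, ← Finset.sum_mul]
    have h1 := sum_lowChar_mul_pow (c i₀) M 1
    simp only [one_pow, mul_one] at h1
    obtain ⟨j, hj⟩ := hi₀
    rw [h1, Finset.prod_eq_zero (i := j), zero_mul]
    · by_contra h
      exact hj (hm _ _ ((hM _).trans (by simpa using h)))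
    · exact sum_pow_eq_zero (stdAddChar_pow_self _) (stdAddChar_ne_one hj)
  refine tendsto_mean_zero_of_window (fun n => ?_) fun ε hε =>
    ⟨P * R, P * R, by positivity, by positivity, fun _ => 0, by simp, fun _ => rfl, fun n => ?_,
      by simp; positivity⟩
  · rw [norm_prod]; simp [norm_lowChar]
  · have : ∀ n, ∑ h ∈ Finset.range (P * R), ∏ i, lowChar (c i) M (n + h) = 0 := by
      intro n
      induction n with
      | zero => simpa using hzero
      | succ n ih =>
        have h1 := Finset.sum_range_succ (fun h => ∏ i, lowChar (c i) M (n + h)) (P * R)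
        have h2 := Finset.sum_range_succ' (fun h => ∏ i, lowChar (c i) M (n + h)) (P * R)
        have h3 : ∏ i, lowChar (c i) M (n + P * R) = ∏ i, lowChar (c i) M n := hper n
        rw [h1, ih, h3, zero_add, add_zero] at h2
        simp only [add_assoc, add_comm 1]
        exact left_eq_add.1 (h2.trans (add_comm _ _))
    rw [this]; simp
end

lemma digitChar_window {q : ℕ} [NeZero q] (hq : 1 < q) (c : ℕ → ZMod q) {M n r h : ℕ}
    (hr : r % q ^ M = n % q ^ M) (hh : n % q ^ M + h < q ^ M) :
    digitChar c (n + h) = digitChar c (r + h) *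
      (highChar c M (n / q ^ M) * (highChar c M (r / q ^ M))⁻¹) := by
  have hlt : h < q ^ M := (Nat.le_add_left _ _).trans_lt hh
  have hdiv : ∀ a, a % q ^ M = n % q ^ M → (a + h) / q ^ M = a / q ^ M := by
    intro a ha
    rw [Nat.add_div_eq_of_add_mod_lt (by rw [ha, Nat.mod_eq_of_lt hlt]; exact hh),
      Nat.div_eq_of_lt hlt, add_zero]
  have hne : highChar c M (r / q ^ M) ≠ 0 := by
    rw [← norm_ne_zero_iff, norm_highChar]; exact one_ne_zero
  rw [digitChar_eq_low_mul_high c hq M (n + h), digitChar_eq_low_mul_high c hq M (r + h),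
    hdiv n rfl, hdiv r hr, lowChar_congr c (m := M) (a := n + h) (b := r + h)
      (by rw [Nat.add_mod, ← hr, ← Nat.add_mod])]
  field_simp

lemma norm_sum_digitChar_mul_le {q : ℕ} [NeZero q] (hq : 1 < q) (c : ℕ → ZMod q) (m n : ℕ)
    (b : ℕ → ℂ) :
    ‖∑ h ∈ Finset.range (q ^ m), digitChar c (n + h) * b h‖
      ≤ ‖hankelCoeff (q ^ m) (lowChar c m) b (n % q ^ m + q ^ m)‖
        + ‖hankelCoeff (q ^ m) (lowChar c m) b (n % q ^ m)‖ := by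
  set P := q ^ m with hPdef
  have hP : 0 < P := pow_pos (by omega) _
  have key : ∑ h ∈ Finset.range P, digitChar c (n + h) * b h
      = highChar c m (n / P) * hankelCoeff P (lowChar c m) b (n % P + P)
        + highChar c m (n / P + 1) * hankelCoeff P (lowChar c m) b (n % P) := by
    rw [hankelCoeff_add, hankelCoeff_of_lt _ _ (Nat.mod_lt _ hP), Finset.mul_sum, Finset.mul_sum,
      ← Finset.sum_add_distrib]
    refine Finset.sum_congr rfl fun h hh => ?_
    have hh := Finset.mem_range.1 hh
    rw [digitChar_eq_low_mul_high c hq m, ← hPdef]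
    split_ifs with h1
    · rw [Nat.add_div_eq_of_add_mod_lt (by rwa [Nat.mod_eq_of_lt hh]), Nat.div_eq_of_lt hh,
        add_zero, lowChar_congr c (m := m) (a := n + h) (b := n % P + h)
          (by rw [Nat.mod_add_mod])]
      ring
    · rw [Nat.add_div_eq_of_le_mod_add_mod (by rw [Nat.mod_eq_of_lt hh]; omega) hP,
        Nat.div_eq_of_lt hh, add_zero, lowChar_congr c (m := m) (a := n + h) (b := n % P + h - P)]
      · ring
      · rw [← hPdef, ← Nat.add_mod_right (n % P + h - P), Nat.sub_add_cancel (by omega),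
          Nat.mod_add_mod]
  rw [key]
  refine (norm_add_le _ _).trans ?_
  simp [norm_highChar]

lemma sum_carry_le {Q P k : ℕ} :
    ∑ n ∈ Finset.range (Q * k), (if Q < n % Q + P then (1 : ℝ) else 0) ≤ k * P := by
  have h1 : ∑ r ∈ Finset.range Q, (if Q < r + P then (1 : ℝ) else 0) ≤ P := by
    rw [← Finset.sum_filter]
    have : ((Finset.range Q).filter fun r => Q < r + P).card ≤ P := by
      refine (Finset.card_le_card (t := Finset.Ico (Q - P) Q) fun r => ?_).trans ?_
      · simp only [Finset.mem_filter, Finset.mem_range, Finset.mem_Ico]; omega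
      · rw [Nat.card_Ico]; omega
    simpa using this
  rw [sum_range_mul_eq]
  have h2 : ∀ j ∈ Finset.range k, ∑ r ∈ Finset.range Q,
      (if Q < (r + Q * j) % Q + P then (1 : ℝ) else 0) ≤ P := by
    intro j _
    refine le_of_eq_of_le (Finset.sum_congr rfl fun r hr => ?_) h1
    rw [Nat.add_mul_mod_self_left, Nat.mod_eq_of_lt (Finset.mem_range.1 hr)]
  refine (Finset.sum_le_sum h2).trans (by simp)

section
variable {ι : Type*} [Fintype ι] {q : ι → ℕ} [∀ i, NeZero (q i)]

lemma tendsto_mean_digitChar_of_infinite [DecidableEq ι] (hq : ∀ i, (q i).Prime)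
    (hdist : Function.Injective q) (c : ∀ i, ℕ → ZMod (q i)) (i₀ : ι)
    (hi₀ : ∀ m, ∃ j, m ≤ j ∧ c i₀ j ≠ 0) :
    Filter.Tendsto (fun N : ℕ => (∑ n ∈ Finset.range N, ∏ i, digitChar (c i) n) / N)
      Filter.atTop (nhds 0) := by
  have hbd : ∀ (s : Finset ι) n, ‖∏ i ∈ s, digitChar (c i) n‖ = 1 := by
    intro s n; rw [norm_prod]; simp [norm_digitChar]
  refine tendsto_mean_zero_of_window (fun n => (hbd _ n).le) fun δ hδ => ?_
  set ε := δ / 3 with hε_def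
  have hε : 0 < ε := by positivity
  obtain ⟨m, hm⟩ := norm_sum_lowChar_mul_pow_le (hq i₀).one_lt (c i₀) hi₀ hε
  set P := q i₀ ^ m with hPdef
  have hP : 0 < P := pow_pos (hq _).pos _
  have hP' : (0 : ℝ) < P := by exact_mod_cast hP
  obtain ⟨M, hM⟩ := pow_unbounded_of_one_lt (P * Fintype.card ι / ε) one_lt_two
  have hcard : (0 : ℝ) < Fintype.card ι := by exact_mod_cast Fintype.card_pos_iff.2 ⟨i₀⟩
  have hMq : ∀ i, P * Fintype.card ι ≤ ε * (q i : ℝ) ^ M := by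
    intro i
    rw [div_lt_iff₀ hε] at hM
    have : (2 : ℝ) ^ M ≤ (q i : ℝ) ^ M := by
      gcongr; exact_mod_cast (hq i).two_le
    nlinarith
  set R := ∏ i ∈ Finset.univ.erase i₀, q i ^ M
  have hR : 0 < R := Finset.prod_pos fun i _ => pow_pos (hq _).pos _
  set b : ℕ → ℕ → ℂ := fun r h => ∏ i ∈ Finset.univ.erase i₀, digitChar (c i) (r + h)
  set T : ℕ → ℕ → ℝ := fun ν r => ‖hankelCoeff P (lowChar (c i₀) m) (b r) (ν + P)‖
        + ‖hankelCoeff P (lowChar (c i₀) m) (b r) ν‖ with hT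
  set w : ℕ → ℝ := fun n => ∑ i ∈ Finset.univ.erase i₀,
    if q i ^ M < n % q i ^ M + P then (1 : ℝ) else 0 with hw
  have hT0 : ∀ ν r, 0 ≤ T ν r := fun ν r => by positivity
  have hw0 : ∀ n, 0 ≤ w n := fun n => Finset.sum_nonneg fun i _ => by split_ifs <;> simp
  have hdvd : ∀ i ∈ Finset.univ.erase i₀, q i ^ M ∣ R := fun i hi =>
    Finset.dvd_prod_of_mem (fun i => q i ^ M) hi
  refine ⟨P, P * R, hP, by positivity, fun n => w n + 1 / P * T (n % P) (n % R),
    fun n => add_nonneg (hw0 n) (mul_nonneg (by positivity) (hT0 _ _)), fun n => ?_, fun n => ?_, ?_⟩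
  · simp only [Nat.add_mul_mod_self_left, Nat.add_mul_mod_self_right, hw]
    congr 1
    refine Finset.sum_congr rfl fun i hi => ?_
    obtain ⟨k, hk⟩ := hdvd i hi
    rw [hk, mul_left_comm, Nat.add_mul_mod_self_left]
  · by_cases hbad : ∃ i ∈ Finset.univ.erase i₀, q i ^ M < n % q i ^ M + P
    · obtain ⟨i, hi, hlt⟩ := hbad
      have h1 : 1 ≤ w n := by
        refine le_trans ?_ (Finset.single_le_sum
          (f := fun i => if q i ^ M < n % q i ^ M + P then (1 : ℝ) else 0)
          (fun i _ => by split_ifs <;> simp) hi)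
        simp [hlt]
      refine (norm_sum_le_of_le _ fun h _ => (hbd Finset.univ (n + h)).le).trans ?_
      have h2 := hT0 (n % P) (n % R)
      simp only [Finset.sum_const, Finset.card_range, nsmul_eq_mul]
      gcongr
      have : 0 ≤ 1 / (P : ℝ) * T (n % P) (n % R) := by positivity
      linarith
    · push Not at hbad
      set κ := ∏ i ∈ Finset.univ.erase i₀, (highChar (c i) M (n / q i ^ M) *
        (highChar (c i) M ((n % R) / q i ^ M))⁻¹)
      have hκ : ‖κ‖ = 1 := by
        simp only [κ, norm_prod, norm_mul, norm_inv, norm_highChar]; simp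
      have h1 : ∑ h ∈ Finset.range P, ∏ i, digitChar (c i) (n + h)
          = κ * ∑ h ∈ Finset.range P, digitChar (c i₀) (n + h) * b (n % R) h := by
        rw [Finset.mul_sum]
        refine Finset.sum_congr rfl fun h hh => ?_
        rw [← Finset.mul_prod_erase _ _ (Finset.mem_univ i₀)]
        have : ∏ i ∈ Finset.univ.erase i₀, digitChar (c i) (n + h) = b (n % R) h * κ := by
          simp only [b, κ]
          rw [← Finset.prod_mul_distrib]
          refine Finset.prod_congr rfl fun i hi => ?_
          refine digitChar_window (hq i).one_lt _ (Nat.mod_mod_of_dvd _ (hdvd i hi)) ?_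
          have := hbad i hi
          have := Finset.mem_range.1 hh
          omega
        rw [this]; ring
      rw [h1, norm_mul, hκ, one_mul]
      refine (norm_sum_digitChar_mul_le (hq i₀).one_lt _ _ _ _).trans ?_
      have : (P : ℝ) * (w n + 1 / P * T (n % P) (n % R)) = P * w n + T (n % P) (n % R) := by
        field_simp
      rw [this]
      have := mul_nonneg hP'.le (hw0 n)
      simp only [hT]
      linarith
  · rw [Finset.sum_add_distrib, ← Finset.mul_sum, sum_range_crt hP hR
      (coprime_pow_prod_erase hq hdist i₀ m M) T]
    have hTsum : ∀ r, ∑ ν ∈ Finset.range P, T ν r ≤ 2 * ε * P ^ 2 := by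
      intro r
      refine le_trans (le_of_eq ?_) (sum_norm_hankelCoeff_le (P := P) (A := lowChar (c i₀) m)
        (b := b r) (fun h => ?_) hε.le (by simpa [hPdef] using hm))
      · simp only [hT]
        rw [two_mul, Finset.sum_range_add, Finset.sum_add_distrib, add_comm]
        simp only [add_comm P]
      · exact (hbd _ _).le
    have h1 : ∑ ν ∈ Finset.range P, ∑ r ∈ Finset.range R, T ν r ≤ R * (2 * ε * P ^ 2) := by
      rw [Finset.sum_comm]
      exact (Finset.sum_le_sum fun r _ => hTsum r).trans (by simp)
    have h2 : ∑ n ∈ Finset.range (P * R), w n ≤ ε * (P * R) := by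
      simp only [hw]
      rw [Finset.sum_comm]
      calc _ ≤ ∑ i ∈ Finset.univ.erase i₀, ε * (P * R) / Fintype.card ι := by
            refine Finset.sum_le_sum fun i hi => ?_
            obtain ⟨k, hk⟩ := hdvd i hi
            rw [hk, mul_left_comm]
            refine sum_carry_le.trans ?_
            rw [le_div_iff₀ hcard]
            push_cast
            have := mul_le_mul_of_nonneg_left (hMq i) (by positivity : (0 : ℝ) ≤ P * k)
            linarith
        _ ≤ ∑ i : ι, ε * (P * R) / Fintype.card ι :=
            Finset.sum_le_sum_of_subset_of_nonneg (Finset.erase_subset _ _)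
              fun _ _ _ => by positivity
        _ = ε * (P * R) := by
            rw [Finset.sum_const, Finset.card_univ, nsmul_eq_mul]
            field_simp
    have h3 : 1 / (P : ℝ) * ∑ ν ∈ Finset.range P, ∑ r ∈ Finset.range R, T ν r
        ≤ 2 * ε * (P * R) := by
      rw [one_div_mul_eq_div, div_le_iff₀ hP']
      linarith
    push_cast
    have : δ = 3 * ε := by rw [hε_def]; ring
    rw [this]
    linarith

/-- Products of digit characters to distinct prime bases have mean value zero as soon as one of
them is nontrivial. -/
lemma tendsto_mean_digitChar (hq : ∀ i, (q i).Prime)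
    (hdist : Function.Injective q) (c : ∀ i, ℕ → ZMod (q i)) (h : ∃ i j, c i j ≠ 0) :
    Filter.Tendsto (fun N : ℕ => (∑ n ∈ Finset.range N, ∏ i, digitChar (c i) n) / N)
      Filter.atTop (nhds 0) := by
  classical
  by_cases hfin : ∀ i, ∃ m, ∀ j, m ≤ j → c i j = 0
  · obtain ⟨i₀, hi₀⟩ := h
    exact tendsto_mean_digitChar_of_finite hq hdist c i₀ hi₀ hfin
  · push Not at hfin
    obtain ⟨i₀, hi₀⟩ := hfin
    exact tendsto_mean_digitChar_of_infinite hq hdist c i₀ hi₀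
end

/-- The index of the elementary interval of length `b ^ (-K)` with the given leading digits. -/
def cellIndex {b K : ℕ} [NeZero b] (w : Fin K → ZMod b) : Fin (b ^ K) :=
  finFunctionFinEquiv fun i => ⟨(w i.rev).val, ZMod.val_lt _⟩

lemma cellIndex_injective {b K : ℕ} [NeZero b] :
    Function.Injective (cellIndex : (Fin K → ZMod b) → Fin (b ^ K)) := by
  intro w w' h
  have h1 := finFunctionFinEquiv.injective h
  funext i
  have h2 := congrArg Fin.val (congrFun h1 i.rev)
  simp only [Fin.rev_rev] at h2
  exact ZMod.val_injective b h2

lemma cellIndex_bijective {b K : ℕ} [NeZero b] :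
    Function.Bijective (cellIndex : (Fin K → ZMod b) → Fin (b ^ K)) := by
  rw [Fintype.bijective_iff_injective_and_card]
  exact ⟨cellIndex_injective, by simp [ZMod.card]⟩

lemma tsum_mem_cell {b : ℕ} [NeZero b] (y : ℕ → ZMod b) (K : ℕ) :
    ((cellIndex fun k : Fin K => y k : ℕ) : ℝ) / b ^ K ≤ ∑' k, ((y k).val : ℝ) / (b : ℝ) ^ (k + 1) ∧
    ∑' k, ((y k).val : ℝ) / (b : ℝ) ^ (k + 1)
      ≤ ((cellIndex fun k : Fin K => y k : ℕ) + 1 : ℝ) / b ^ K := by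
  have hb : (0 : ℝ) < b := by exact_mod_cast NeZero.pos b
  set D : ℕ → Fin b := fun k => ⟨(y k).val, ZMod.val_lt _⟩
  have h1 : ∑' k, ((y k).val : ℝ) / (b : ℝ) ^ (k + 1) = Real.ofDigits D := by
    simp only [Real.ofDigits, Real.ofDigitsTerm, D, div_eq_mul_inv]
  have h2 : ∑ i ∈ Finset.range K, Real.ofDigitsTerm D i
      = ((cellIndex fun k : Fin K => y k : ℕ) : ℝ) / b ^ K := by
    rw [← Fin.sum_univ_eq_sum_range, cellIndex, finFunctionFinEquiv_apply, Nat.cast_sum,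
      Finset.sum_div, ← Equiv.sum_comp Fin.revPerm]
    refine Finset.sum_congr rfl fun i _ => ?_
    simp only [Real.ofDigitsTerm, D, Fin.revPerm_apply]
    have e : b ^ K = b ^ ((i.rev : ℕ) + 1) * b ^ (i : ℕ) := by
      rw [← pow_add, Fin.val_rev]; congr 1; omega
    have e' : (b : ℝ) ^ K = (b : ℝ) ^ ((i.rev : ℕ) + 1) * (b : ℝ) ^ (i : ℕ) := by exact_mod_cast e
    rw [e']
    push_cast
    field_simp
  have h3 := Real.ofDigits_nonneg fun i => D (i + K)
  have h4 := Real.ofDigits_le_one fun i => D (i + K)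
  rw [h1, Real.ofDigits_eq_sum_add_ofDigits D K, h2, add_div, one_div]
  have h5 : (0 : ℝ) < ((b : ℝ) ^ K)⁻¹ := by positivity
  constructor
  · nlinarith
  · nlinarith

lemma card_filter_cellIndex {b K : ℕ} [NeZero b] (p : ℕ → Prop) [DecidablePred p]
    (hp : ∀ a, p a → a < b ^ K) (s : Finset ℕ) (hs : ∀ a, a ∈ s ↔ p a) :
    (Finset.univ.filter fun w : Fin K → ZMod b => p (cellIndex w)).card = s.card := by
  refine Finset.card_bij (fun w _ => (cellIndex w : ℕ)) ?_ ?_ ?_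
  · intro w hw
    exact (hs _).2 (Finset.mem_filter.1 hw).2
  · intro w _ w' _ h
    exact cellIndex_injective (Fin.ext h)
  · intro a ha
    have hpa := (hs _).1 ha
    obtain ⟨w, hw⟩ := cellIndex_bijective.2 ⟨a, hp a hpa⟩
    exact ⟨w, by simp [hw, hpa], by simp [hw]⟩

open Classical in
/-- The cells whose closure lies in `[u, v)`. -/
noncomputable def innerCells (b K : ℕ) [NeZero b] (u v : ℝ) : Finset (Fin K → ZMod b) :=
  Finset.univ.filter fun w => u ≤ (cellIndex w : ℕ) / (b : ℝ) ^ K ∧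
    ((cellIndex w : ℕ) + 1) / (b : ℝ) ^ K < v

open Classical in
/-- The cells whose closure meets `[u, v)`. -/
noncomputable def outerCells (b K : ℕ) [NeZero b] (u v : ℝ) : Finset (Fin K → ZMod b) :=
  Finset.univ.filter fun w => (cellIndex w : ℕ) / (b : ℝ) ^ K < v ∧
    u ≤ ((cellIndex w : ℕ) + 1) / (b : ℝ) ^ K

section
variable {b : ℕ} [NeZero b] {u v : ℝ}

lemma abs_card_innerCells_sub_le (K : ℕ) (hu : 0 ≤ u) (huv : u ≤ v) (hv : v ≤ 1) :
    |((innerCells b K u v).card : ℝ) / b ^ K - (v - u)| ≤ 3 / b ^ K := by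
  classical
  have hQ : (0 : ℝ) < (b : ℝ) ^ K := by have := NeZero.pos b; positivity
  have hcard : (innerCells b K u v).card
      = (Finset.Ico ⌈u * b ^ K⌉₊ (⌈v * b ^ K⌉₊ - 1)).card := by
    refine card_filter_cellIndex (fun a => u ≤ a / (b : ℝ) ^ K ∧ (a + 1) / (b : ℝ) ^ K < v) ?_ _ ?_
    · rintro a ⟨_, h⟩
      have := h.trans_le hv
      rw [div_lt_one hQ] at this
      have : (a : ℝ) < (b ^ K : ℕ) := by push_cast; linarith
      exact_mod_cast this
    · intro a
      rw [Finset.mem_Ico, Nat.ceil_le, le_div_iff₀ hQ, div_lt_iff₀ hQ, Nat.lt_sub_iff_add_lt,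
        Nat.lt_ceil]
      push_cast; rfl
  have hmono : ⌈u * b ^ K⌉₊ ≤ ⌈v * b ^ K⌉₊ := Nat.ceil_mono (by gcongr)
  have h1 := Nat.le_ceil (u * b ^ K)
  have h2 := Nat.ceil_lt_add_one (a := u * b ^ K) (by positivity)
  have h3 := Nat.le_ceil (v * b ^ K)
  have h4 := Nat.ceil_lt_add_one (a := v * b ^ K) (mul_nonneg (hu.trans huv) hQ.le)
  have hvu : u * (b : ℝ) ^ K ≤ v * b ^ K := by gcongr
  rw [hcard, Nat.card_Ico]
  set m := ⌈u * b ^ K⌉₊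
  set M := ⌈v * b ^ K⌉₊
  have e1 : (M : ℝ) ≤ ((M - 1 - m : ℕ) : ℝ) + 1 + m := by
    exact_mod_cast (by omega : M ≤ (M - 1 - m) + 1 + m)
  have e2 : ((M - 1 - m : ℕ) : ℝ) + m ≤ M := by
    exact_mod_cast (by omega : (M - 1 - m) + m ≤ M)
  rw [div_sub' hQ.ne', abs_div, abs_of_pos hQ]
  gcongr
  rw [abs_le]
  constructor <;> linarith

lemma abs_card_outerCells_sub_le (K : ℕ) (hu : 0 ≤ u) (huv : u ≤ v) (hv : v ≤ 1) :
    |((outerCells b K u v).card : ℝ) / b ^ K - (v - u)| ≤ 3 / b ^ K := by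
  classical
  have hQ : (0 : ℝ) < (b : ℝ) ^ K := by have := NeZero.pos b; positivity
  have hcard : (outerCells b K u v).card
      = (Finset.Ico (⌈u * b ^ K⌉₊ - 1) ⌈v * b ^ K⌉₊).card := by
    refine card_filter_cellIndex (fun a => a / (b : ℝ) ^ K < v ∧ u ≤ (a + 1) / (b : ℝ) ^ K) ?_ _ ?_
    · rintro a ⟨h, _⟩
      have := h.trans_le hv
      rw [div_lt_one hQ] at this
      exact_mod_cast this
    · intro a
      rw [Finset.mem_Ico, Nat.sub_le_iff_le_add, Nat.ceil_le, le_div_iff₀ hQ, div_lt_iff₀ hQ,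
        Nat.lt_ceil]
      push_cast
      exact and_comm
  have hmono : ⌈u * b ^ K⌉₊ ≤ ⌈v * b ^ K⌉₊ := Nat.ceil_mono (by gcongr)
  have h1 := Nat.le_ceil (u * b ^ K)
  have h2 := Nat.ceil_lt_add_one (a := u * b ^ K) (by positivity)
  have h3 := Nat.le_ceil (v * b ^ K)
  have h4 := Nat.ceil_lt_add_one (a := v * b ^ K) (mul_nonneg (hu.trans huv) hQ.le)
  have hvu : u * (b : ℝ) ^ K ≤ v * b ^ K := by gcongr
  rw [hcard, Nat.card_Ico]
  set m := ⌈u * b ^ K⌉₊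
  set M := ⌈v * b ^ K⌉₊
  have e1 : ((M - (m - 1) : ℕ) : ℝ) + m ≤ M + 1 := by
    exact_mod_cast (by omega : (M - (m - 1)) + m ≤ M + 1)
  have e2 : (M : ℝ) ≤ ((M - (m - 1) : ℕ) : ℝ) + m := by
    exact_mod_cast (by omega : M ≤ (M - (m - 1)) + m)
  rw [div_sub' hQ.ne', abs_div, abs_of_pos hQ]
  gcongr
  rw [abs_le]
  constructor <;> linarith

lemma card_div_pow_mem_unit {K : ℕ} (s : Finset (Fin K → ZMod b)) :
    0 ≤ (s.card : ℝ) / b ^ K ∧ (s.card : ℝ) / b ^ K ≤ 1 := by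
  have hQ : (0 : ℝ) < (b : ℝ) ^ K := by have := NeZero.pos b; positivity
  refine ⟨by positivity, (div_le_one hQ).2 ?_⟩
  have := Finset.card_le_univ s
  simp only [Fintype.card_pi, ZMod.card, Finset.prod_const, Finset.card_univ,
    Fintype.card_fin] at this
  exact_mod_cast this
end

lemma abs_prod_sub_prod_le {ι : Type*} (s : Finset ι) {f g : ι → ℝ}
    (hf : ∀ i ∈ s, 0 ≤ f i ∧ f i ≤ 1) (hg : ∀ i ∈ s, 0 ≤ g i ∧ g i ≤ 1) :
    |∏ i ∈ s, f i - ∏ i ∈ s, g i| ≤ ∑ i ∈ s, |f i - g i| := by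
  classical
  induction s using Finset.induction_on with
  | empty => simp
  | insert a s ha ih =>
    simp only [Finset.forall_mem_insert] at hf hg
    rw [Finset.prod_insert ha, Finset.prod_insert ha, Finset.sum_insert ha]
    have h1 := ih hf.2 hg.2
    have h2 : |∏ i ∈ s, f i| ≤ 1 := by
      rw [abs_of_nonneg (Finset.prod_nonneg fun i hi => (hf.2 i hi).1)]
      exact Finset.prod_le_one (fun i hi => (hf.2 i hi).1) fun i hi => (hf.2 i hi).2
    have h3 : |g a| ≤ 1 := by rw [abs_of_nonneg hg.1.1]; exact hg.1.2
    have e : f a * ∏ i ∈ s, f i - g a * ∏ i ∈ s, g i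
        = (f a - g a) * ∏ i ∈ s, f i + g a * (∏ i ∈ s, f i - ∏ i ∈ s, g i) := by ring
    rw [e]
    refine (abs_add_le _ _).trans ?_
    rw [abs_mul, abs_mul]
    nlinarith [abs_nonneg (f a - g a), abs_nonneg (∏ i ∈ s, f i - ∏ i ∈ s, g i)]

section
variable {ι : Type*} [Fintype ι]

lemma natCard_lt_and_eq {N : ℕ} (p : ℕ → Prop) [DecidablePred p] :
    Nat.card {n : ℕ // n < N ∧ p n} = ((Finset.range N).filter p).card :=
  Nat.subtype_card _ fun n => by simp

lemma card_filter_range_div_le_one (N : ℕ) (p : ℕ → Prop) [DecidablePred p] :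
    (((Finset.range N).filter p).card : ℝ) / N ≤ 1 := by
  refine div_le_one_of_le₀ ?_ (Nat.cast_nonneg _)
  have := Finset.card_filter_le (Finset.range N) p
  rw [Finset.card_range] at this
  exact_mod_cast this

lemma disc_nonneg (z : ℕ → ι → ℝ) (N : ℕ) : 0 ≤ disc z N := by
  refine Real.sSup_nonneg ?_
  rintro r ⟨u, v, -, rfl⟩
  exact abs_nonneg _

lemma disc_le {z : ℕ → ι → ℝ} {N : ℕ} {δ : ℝ}
    (h : ∀ u v : ι → ℝ, (∀ i, 0 ≤ u i ∧ u i ≤ v i ∧ v i ≤ 1) →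
      |(Nat.card {n : ℕ // n < N ∧ ∀ i, u i ≤ z n i ∧ z n i < v i} : ℝ) / N
          - ∏ i, (v i - u i)| ≤ δ) : disc z N ≤ δ := by
  refine csSup_le ⟨_, fun _ => 0, fun _ => 0, by simp, rfl⟩ ?_
  rintro r ⟨u, v, huv, rfl⟩
  exact h u v huv

lemma le_disc (z : ℕ → ι → ℝ) (N : ℕ) {u v : ι → ℝ}
    (huv : ∀ i, 0 ≤ u i ∧ u i ≤ v i ∧ v i ≤ 1) :
    |(Nat.card {n : ℕ // n < N ∧ ∀ i, u i ≤ z n i ∧ z n i < v i} : ℝ) / N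
          - ∏ i, (v i - u i)| ≤ disc z N := by
  classical
  refine le_csSup ⟨1, ?_⟩ ⟨u, v, huv, rfl⟩
  rintro r ⟨u, v, huv, rfl⟩
  rw [natCard_lt_and_eq]
  have h1 := card_filter_range_div_le_one N fun n => ∀ i, u i ≤ z n i ∧ z n i < v i
  have h2 : (0 : ℝ) ≤ (((Finset.range N).filter
    fun n => ∀ i, u i ≤ z n i ∧ z n i < v i).card : ℝ) / N := by positivity
  have h3 : 0 ≤ ∏ i, (v i - u i) :=
    Finset.prod_nonneg fun i _ => sub_nonneg.2 (huv i).2.1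
  have h4 : ∏ i, (v i - u i) ≤ 1 :=
    Finset.prod_le_one (fun i _ => sub_nonneg.2 (huv i).2.1)
      fun i _ => by linarith [(huv i).1, (huv i).2.2]
  rw [abs_le]
  constructor <;> linarith

/-- The discrepancy of a projection is controlled by that of the full sequence, even when some
points lie outside the unit cube. -/
lemma disc_comp_le {κ : Type*} [Fintype κ] (z : ℕ → ι → ℝ) {e : κ → ι}
    (he : Function.Injective e) {N : ℕ} (hN : 0 < N) :
    disc (fun n j => z n (e j)) N ≤ 2 * disc z N := by
  classical
  have hN' : (0 : ℝ) < N := by exact_mod_cast hN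
  refine disc_le fun u v huv => ?_
  set U := Function.extend e u (0 : ι → ℝ)
  set V := Function.extend e v (1 : ι → ℝ)
  have hUe : ∀ j, U (e j) = u j := he.extend_apply u (0 : ι → ℝ)
  have hVe : ∀ j, V (e j) = v j := he.extend_apply v (1 : ι → ℝ)
  have hU : ∀ i, (¬∃ j, e j = i) → U i = 0 := fun i hi => Function.extend_apply' u (0 : ι → ℝ) i hi
  have hV : ∀ i, (¬∃ j, e j = i) → V i = 1 := fun i hi => Function.extend_apply' v (1 : ι → ℝ) i hi
  have hUV : ∀ i, 0 ≤ U i ∧ U i ≤ V i ∧ V i ≤ 1 := by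
    intro i
    by_cases hi : ∃ j, e j = i
    · obtain ⟨j, rfl⟩ := hi
      rw [hUe, hVe]; exact huv j
    · rw [hU i hi, hV i hi]; norm_num
  have h1 := le_disc z N hUV
  have h2 := le_disc z N (u := fun _ => 0) (v := fun _ => 1) (by simp)
  have hprod : ∏ j, (v j - u j) = ∏ i, (V i - U i) := by
    refine Fintype.prod_of_injective e he _ _ (fun i hi => ?_) fun j => by rw [hUe, hVe]
    rw [hU i hi, hV i hi, sub_zero]
  rw [natCard_lt_and_eq] at h1 h2 ⊢
  rw [hprod]
  simp only [sub_zero, Finset.prod_const_one] at h2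
  set S := (Finset.range N).filter fun n => ∀ j, u j ≤ z n (e j) ∧ z n (e j) < v j
  set S₁ := (Finset.range N).filter fun n => ∀ i, U i ≤ z n i ∧ z n i < V i
  set S₀ := (Finset.range N).filter fun n => ∀ i, 0 ≤ z n i ∧ z n i < 1
  have hS₁ : S₁ ⊆ S := by
    intro n hn
    obtain ⟨ha, hb⟩ := Finset.mem_filter.1 hn
    refine Finset.mem_filter.2 ⟨ha, fun j => ?_⟩
    have := hb (e j)
    rwa [hUe, hVe] at this
  have hS : S ⊆ S₁ ∪ (Finset.range N \ S₀) := by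
    intro n hn
    obtain ⟨ha, hb⟩ := Finset.mem_filter.1 hn
    by_cases h : n ∈ S₀
    · refine Finset.mem_union_left _ (Finset.mem_filter.2 ⟨ha, fun i => ?_⟩)
      by_cases hi : ∃ j, e j = i
      · obtain ⟨j, rfl⟩ := hi
        rw [hUe, hVe]; exact hb j
      · rw [hU i hi, hV i hi]; exact (Finset.mem_filter.1 h).2 i
    · exact Finset.mem_union_right _ (Finset.mem_sdiff.2 ⟨ha, h⟩)
  have c1 : (S₁.card : ℝ) / N ≤ S.card / N := by
    gcongr
  have c2 : (S.card : ℝ) / N ≤ S₁.card / N + (1 - S₀.card / N) := by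
    have h3 := (Finset.card_le_card hS).trans (Finset.card_union_le _ _)
    have h4 := Finset.card_sdiff_add_card_eq_card (Finset.filter_subset
      (fun n => ∀ i, 0 ≤ z n i ∧ z n i < 1) (Finset.range N))
    rw [Finset.card_range] at h4
    have h5 : S.card + S₀.card ≤ S₁.card + N := by
      simp only [S₀] at h3 ⊢; omega
    have h6 : (S.card : ℝ) + S₀.card ≤ S₁.card + N := by exact_mod_cast h5
    have : (S₁.card : ℝ) / N + (1 - S₀.card / N) = (S₁.card + N - S₀.card) / N := by
      field_simp
      ring
    rw [this]
    gcongr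
    linarith
  rw [abs_le] at h1 h2 ⊢
  constructor <;> linarith

/-- A sequence whose leading digit blocks are equidistributed has discrepancy tending to zero. -/
lemma tendsto_disc_of_cells {b : ι → ℕ} [∀ p, NeZero (b p)] (hb : ∀ p, 2 ≤ b p)
    (y : ℕ → (p : ι) → ℕ → ZMod (b p))
    (hcell : ∀ (K : ℕ) (w : (p : ι) → Fin K → ZMod (b p)),
      Filter.Tendsto (fun N : ℕ => (((Finset.range N).filter
        fun n => (fun (p : ι) (k : Fin K) => y n p k) = w).card : ℝ) / N)
        Filter.atTop (nhds (∏ p, 1 / (b p : ℝ) ^ K))) :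
    Filter.Tendsto (fun N => disc (fun n p => ∑' k, ((y n p k).val : ℝ) / (b p : ℝ) ^ (k + 1)) N)
      Filter.atTop (nhds 0) := by
  classical
  set z : ℕ → ι → ℝ := fun n p => ∑' k, ((y n p k).val : ℝ) / (b p : ℝ) ^ (k + 1)
  set cell : (K : ℕ) → ℕ → (p : ι) → Fin K → ZMod (b p) := fun K n p k => y n p k with hcell_def
  set μ : (K : ℕ) → ℕ → ((p : ι) → Fin K → ZMod (b p)) → ℝ := fun K N w =>
    (((Finset.range N).filter fun n => cell K n = w).card : ℝ) / N with hμ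
  have hbK : ∀ p K, (0 : ℝ) < (b p : ℝ) ^ K := fun p K => by have := hb p; positivity
  have key : ∀ K N, disc z N ≤ ∑ w, |μ K N w - ∏ p, 1 / (b p : ℝ) ^ K|
      + ∑ p, 3 / (b p : ℝ) ^ K := by
    intro K N
    set η := ∑ w, |μ K N w - ∏ p, 1 / (b p : ℝ) ^ K|
    refine disc_le fun u v huv => ?_
    rw [natCard_lt_and_eq]
    have hcount : ∀ S : (p : ι) → Finset (Fin K → ZMod (b p)),
        |(((Finset.range N).filter fun n => cell K n ∈ Fintype.piFinset S).card : ℝ) / N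
          - ∏ p, ((S p).card : ℝ) / (b p : ℝ) ^ K| ≤ η := by
      intro S
      have e1 : (((Finset.range N).filter fun n => cell K n ∈ Fintype.piFinset S).card : ℝ) / N
          = ∑ w ∈ Fintype.piFinset S, μ K N w := by
        simp only [hμ]
        rw [← Finset.sum_div, ← Nat.cast_sum,
          Finset.card_eq_sum_card_fiberwise (f := cell K) (t := Fintype.piFinset S)
            (s := (Finset.range N).filter fun n => cell K n ∈ Fintype.piFinset S)
            (fun n hn => (Finset.mem_filter.1 hn).2)]
        congr 2
        refine Finset.sum_congr rfl fun w hw => ?_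
        rw [Finset.filter_filter]
        congr 1
        refine Finset.filter_congr fun n _ => ?_
        constructor
        · exact fun h => h.2
        · rintro rfl; exact ⟨hw, rfl⟩
      have e2 : ∏ p, ((S p).card : ℝ) / (b p : ℝ) ^ K
          = ∑ w ∈ Fintype.piFinset S, ∏ p, 1 / (b p : ℝ) ^ K := by
        rw [Finset.sum_const, Fintype.card_piFinset, nsmul_eq_mul, Nat.cast_prod,
          ← Finset.prod_mul_distrib]
        simp only [mul_one_div]
      rw [e1, e2, ← Finset.sum_sub_distrib]
      refine (Finset.abs_sum_le_sum_abs _ _).trans ?_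
      exact Finset.sum_le_sum_of_subset_of_nonneg (Finset.subset_univ _)
        fun _ _ _ => abs_nonneg _
    have hvu : ∀ p ∈ Finset.univ, 0 ≤ v p - u p ∧ v p - u p ≤ 1 := fun p _ =>
      ⟨sub_nonneg.2 (huv p).2.1, by linarith [(huv p).1, (huv p).2.2]⟩
    have hin := (abs_prod_sub_prod_le Finset.univ
      (f := fun p => ((innerCells (b p) K (u p) (v p)).card : ℝ) / (b p : ℝ) ^ K)
      (fun p _ => card_div_pow_mem_unit _) hvu).trans (Finset.sum_le_sum fun p _ =>
        abs_card_innerCells_sub_le K (huv p).1 (huv p).2.1 (huv p).2.2)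
    have hout := (abs_prod_sub_prod_le Finset.univ
      (f := fun p => ((outerCells (b p) K (u p) (v p)).card : ℝ) / (b p : ℝ) ^ K)
      (fun p _ => card_div_pow_mem_unit _) hvu).trans (Finset.sum_le_sum fun p _ =>
        abs_card_outerCells_sub_le K (huv p).1 (huv p).2.1 (huv p).2.2)
    have hin' := hcount fun p => innerCells (b p) K (u p) (v p)
    have hout' := hcount fun p => outerCells (b p) K (u p) (v p)
    have c1 : (((Finset.range N).filter fun n => cell K n ∈ Fintype.piFinset
          fun p => innerCells (b p) K (u p) (v p)).card : ℝ) / N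
        ≤ (((Finset.range N).filter fun n => ∀ p, u p ≤ z n p ∧ z n p < v p).card : ℝ) / N := by
      gcongr with n
      intro h p
      have h1 := (Finset.mem_filter.1 (Fintype.mem_piFinset.1 h p)).2
      have h2 := tsum_mem_cell (y n p) K
      exact ⟨h1.1.trans h2.1, h2.2.trans_lt h1.2⟩
    have c2 : (((Finset.range N).filter fun n => ∀ p, u p ≤ z n p ∧ z n p < v p).card : ℝ) / N
        ≤ (((Finset.range N).filter fun n => cell K n ∈ Fintype.piFinset
          fun p => outerCells (b p) K (u p) (v p)).card : ℝ) / N := by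
      gcongr with n
      intro h
      refine Fintype.mem_piFinset.2 fun p => Finset.mem_filter.2 ⟨Finset.mem_univ _, ?_⟩
      have h2 := tsum_mem_cell (y n p) K
      exact ⟨h2.1.trans_lt (h p).2, (h p).1.trans h2.2⟩
    rw [abs_le] at hin hout hin' hout' ⊢
    constructor <;> linarith
  rw [Metric.tendsto_atTop]
  intro δ hδ
  have hlim : Filter.Tendsto (fun K : ℕ => ∑ p, 3 / (b p : ℝ) ^ K) Filter.atTop (nhds 0) := by
    rw [← Finset.sum_const_zero (s := (Finset.univ : Finset ι))]
    refine tendsto_finsetSum _ fun p _ => ?_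
    refine tendsto_const_nhds.div_atTop (tendsto_pow_atTop_atTop_of_one_lt ?_)
    exact_mod_cast hb p
  obtain ⟨K, hK⟩ := ((tendsto_order.1 hlim).2 (δ / 2) (by positivity)).exists
  have hη : Filter.Tendsto (fun N => ∑ w, |μ K N w - ∏ p, 1 / (b p : ℝ) ^ K|)
      Filter.atTop (nhds 0) := by
    rw [← Finset.sum_const_zero (s := (Finset.univ : Finset ((p : ι) → Fin K → ZMod (b p))))]
    refine tendsto_finsetSum _ fun w _ => ?_
    have := ((hcell K w).sub_const (∏ p, 1 / (b p : ℝ) ^ K)).abs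
    rw [sub_self, abs_zero] at this
    exact this
  obtain ⟨N₀, hN₀⟩ := Filter.eventually_atTop.1 ((tendsto_order.1 hη).2 (δ / 2) (by positivity))
  refine ⟨N₀, fun N hN => ?_⟩
  rw [Real.dist_0_eq_abs, abs_of_nonneg (disc_nonneg _ _)]
  have := key K N
  have := hN₀ N hN
  linarith
end

lemma indicator_mul_prod_eq_sum_char {ι : Type*} [Fintype ι] [DecidableEq ι] {b : ι → ℕ}
    [∀ p, NeZero (b p)] {K : ℕ} (x w : (p : ι) → Fin K → ZMod (b p)) :
    (if x = w then (1 : ℂ) else 0) * ∏ p, (b p : ℂ) ^ K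
      = ∑ T : (p : ι) → Fin K → ZMod (b p), (∏ p, ∏ k, ZMod.stdAddChar (-(T p k * w p k)))
          * ∏ p, ∏ k, ZMod.stdAddChar (T p k * x p k) := by
  have h1 : ∀ T : (p : ι) → Fin K → ZMod (b p),
      (∏ p, ∏ k, ZMod.stdAddChar (-(T p k * w p k))) * ∏ p, ∏ k, ZMod.stdAddChar (T p k * x p k)
        = ∏ p, ∏ k, ZMod.stdAddChar (T p k * (x p k - w p k)) := by
    intro T
    simp only [← Finset.prod_mul_distrib, ← AddChar.map_add_eq_mul]
    refine Finset.prod_congr rfl fun p _ => Finset.prod_congr rfl fun k _ => ?_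
    congr 1
    ring
  have h2 : ∑ T : (p : ι) → Fin K → ZMod (b p),
      ∏ p, ∏ k, ZMod.stdAddChar (T p k * (x p k - w p k))
        = ∏ p, ∏ k, ∑ t : ZMod (b p), ZMod.stdAddChar (t * (x p k - w p k)) := by
    have := Finset.prod_univ_sum (fun p : ι => (Finset.univ : Finset (Fin K → ZMod (b p))))
      fun p t => ∏ k, ZMod.stdAddChar (t k * (x p k - w p k))
    rw [Fintype.piFinset_univ] at this
    rw [← this]
    refine Finset.prod_congr rfl fun p _ => ?_
    have := Finset.prod_univ_sum (fun _ : Fin K => (Finset.univ : Finset (ZMod (b p))))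
      fun k t => ZMod.stdAddChar (t * (x p k - w p k))
    rw [Fintype.piFinset_univ] at this
    exact this.symm
  simp only [h1, h2, AddChar.sum_mulShift _ (ZMod.isPrimitive_stdAddChar _), ZMod.card]
  by_cases h : x = w
  · subst h; simp
  · rw [if_neg h, zero_mul]
    obtain ⟨p, hp⟩ := Function.ne_iff.1 h
    obtain ⟨k, hk⟩ := Function.ne_iff.1 hp
    refine (Finset.prod_eq_zero (Finset.mem_univ p) ?_).symm
    refine Finset.prod_eq_zero (Finset.mem_univ k) ?_
    rw [if_neg (sub_ne_zero.2 hk), Nat.cast_zero]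

/-- Weyl's criterion for digit blocks. -/
lemma tendsto_cell_of_tendsto_mean_char {ι : Type*} [Fintype ι] [DecidableEq ι] {b : ι → ℕ}
    [∀ p, NeZero (b p)] {K : ℕ} (x : ℕ → (p : ι) → Fin K → ZMod (b p))
    (h : ∀ T : (p : ι) → Fin K → ZMod (b p), T ≠ 0 → Filter.Tendsto (fun N : ℕ =>
      (∑ n ∈ Finset.range N, ∏ p, ∏ k, ZMod.stdAddChar (T p k * x n p k)) / (N : ℂ))
      Filter.atTop (nhds 0))
    (w : (p : ι) → Fin K → ZMod (b p)) :
    Filter.Tendsto (fun N : ℕ => (((Finset.range N).filter fun n => x n = w).card : ℝ) / N)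
      Filter.atTop (nhds (∏ p, 1 / (b p : ℝ) ^ K)) := by
  set B : ℂ := ∏ p, (b p : ℂ) ^ K with hB
  have hB0 : B ≠ 0 := Finset.prod_ne_zero_iff.2 fun p _ =>
    pow_ne_zero _ (Nat.cast_ne_zero.2 (NeZero.ne _))
  have hsum : Filter.Tendsto (fun N : ℕ => ∑ T : (p : ι) → Fin K → ZMod (b p),
      (∏ p, ∏ k, ZMod.stdAddChar (-(T p k * w p k))) *
        ((∑ n ∈ Finset.range N, ∏ p, ∏ k, ZMod.stdAddChar (T p k * x n p k)) / (N : ℂ)))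
      Filter.atTop (nhds (∑ T : (p : ι) → Fin K → ZMod (b p), if T = 0 then 1 else 0)) := by
    refine tendsto_finsetSum _ fun T _ => ?_
    by_cases hT : T = 0
    · subst hT
      refine tendsto_const_nhds.congr' ?_
      filter_upwards [Filter.eventually_gt_atTop 0] with N hN
      have : (N : ℂ) ≠ 0 := Nat.cast_ne_zero.2 hN.ne'
      simp [this]
    · rw [if_neg hT, ← mul_zero (∏ p, ∏ k, ZMod.stdAddChar (-(T p k * w p k)))]
      exact (h T hT).const_mul _
  rw [Finset.sum_ite_eq' Finset.univ, if_pos (Finset.mem_univ _)] at hsum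
  have hC : Filter.Tendsto
      (fun N : ℕ => (((((Finset.range N).filter fun n => x n = w).card : ℝ) / N : ℝ) : ℂ))
      Filter.atTop (nhds (((∏ p, 1 / (b p : ℝ) ^ K : ℝ)) : ℂ)) := by
    have := hsum.div_const B
    have hlim : (((∏ p, 1 / (b p : ℝ) ^ K : ℝ)) : ℂ) = 1 / B := by
      rw [hB]; push_cast; simp
    rw [hlim]
    refine this.congr fun N => ?_
    have : ((((Finset.range N).filter fun n => x n = w).card : ℂ)) * B
        = ∑ T : (p : ι) → Fin K → ZMod (b p), (∏ p, ∏ k, ZMod.stdAddChar (-(T p k * w p k))) *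
          ∑ n ∈ Finset.range N, ∏ p, ∏ k, ZMod.stdAddChar (T p k * x n p k) := by
      simp only [Finset.mul_sum]
      rw [Finset.sum_comm, Finset.natCast_card_filter, Finset.sum_mul]
      exact Finset.sum_congr rfl fun n _ => indicator_mul_prod_eq_sum_char (x n) w
    simp only [← mul_div_assoc]
    rw [← Finset.sum_div, ← this]
    push_cast
    field_simp
  exact_mod_cast (Complex.continuous_re.tendsto _).comp hC

lemma addChar_map_sum {A M κ : Type*} [AddCommMonoid A] [CommMonoid M] (ψ : AddChar A M)
    (s : Finset κ) (f : κ → A) : ψ (∑ i ∈ s, f i) = ∏ i ∈ s, ψ (f i) := by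
  classical
  induction s using Finset.induction_on with
  | empty => simp
  | insert i s hi ih =>
    rw [Finset.sum_insert hi, Finset.prod_insert hi, AddChar.map_add_eq_mul, ih]

/-- If the digital sequence is uniformly distributed, then the rows of its generating matrices are
linearly independent. -/
lemma exists_row_combination_ne_zero {q : ℕ} (hq : q.Prime) {d : ℕ}
    {C : Fin d → ℕ → ℕ → ZMod q}
    (h : Filter.Tendsto (fun N => disc (fun n => digitalSeq d C n) N) Filter.atTop (nhds 0))
    {K : ℕ} {t : Fin d → Fin K → ZMod q} (ht : t ≠ 0) :
    ∃ m, ∑ j, ∑ k, t j k * C j k m ≠ 0 := by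
  classical
  have : Fact q.Prime := ⟨hq⟩
  by_contra! hzero
  have hrel : ∀ n, ∑ j, ∑ k, t j k * digitSum (C j k) n = 0 := by
    intro n
    have e := sum_mul_digitSum (Finset.univ : Finset (Fin d × Fin K)) (fun x => t x.1 x.2)
      (fun x => C x.1 x.2) n
    simp only [Fintype.sum_prod_type, hzero] at e
    rw [e, digitSum_zero_coeff]
  obtain ⟨j₀, hj⟩ := Function.ne_iff.1 ht
  obtain ⟨k₀, hk⟩ := Function.ne_iff.1 hj
  set w : Fin d → Fin K → ZMod q := Pi.single j₀ (Pi.single k₀ 1) with hw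
  have htw : ∑ j, ∑ k, t j k * w j k = t j₀ k₀ := by
    rw [Finset.sum_eq_single j₀, Finset.sum_eq_single k₀]
    · simp [hw]
    · intro k _ hk; simp [hw, hk]
    · simp
    · intro j _ hj; simp [hw, hj]
    · simp
  have hqK : (0 : ℝ) < (q : ℝ) ^ K := pow_pos (Nat.cast_pos.2 hq.pos) K
  set u : Fin d → ℝ := fun j => ((cellIndex (w j) : ℕ) + 1 / 2) / (q : ℝ) ^ K with hu
  set v : Fin d → ℝ := fun j => ((cellIndex (w j) : ℕ) + 1) / (q : ℝ) ^ K with hv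
  have huv : ∀ j, 0 ≤ u j ∧ u j ≤ v j ∧ v j ≤ 1 := by
    intro j
    refine ⟨by positivity, ?_, ?_⟩
    · simp only [hu, hv]; gcongr; norm_num
    · simp only [hv]
      rw [div_le_one hqK]
      exact_mod_cast (cellIndex (w j)).isLt
  have hempty : ∀ n, ¬∀ j, u j ≤ digitalSeq d C n j ∧ digitalSeq d C n j < v j := by
    intro n hn
    have hdig : ∀ j, (fun k : Fin K => digitSum (C j k) n) = w j := by
      intro j
      refine cellIndex_injective (Fin.ext ?_)
      have h1 := tsum_mem_cell (fun k => digitSum (C j k) n) K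
      have h2 := hn j
      change u j ≤ (∑' k, ((digitSum (C j k) n).val : ℝ) / (q : ℝ) ^ (k + 1)) ∧
        (∑' k, ((digitSum (C j k) n).val : ℝ) / (q : ℝ) ^ (k + 1)) < v j at h2
      have h3 := h1.1.trans_lt h2.2
      have h4 := h2.1.trans h1.2
      simp only [hu, hv] at h3 h4
      rw [div_lt_div_iff_of_pos_right hqK] at h3
      rw [div_le_div_iff_of_pos_right hqK] at h4
      have h5 : ((cellIndex (w j) : ℕ) : ℝ)
          < (cellIndex (fun k : Fin K => digitSum (C j k) n) : ℕ) + 1 := by linarith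
      norm_cast at h3 h5
      omega
    refine hk ?_
    rw [Pi.zero_apply, Pi.zero_apply, ← htw, ← hrel n]
    refine Finset.sum_congr rfl fun j _ => Finset.sum_congr rfl fun k _ => ?_
    rw [← congrFun (hdig j) k]
  have hpos : 0 < ∏ j, (v j - u j) := by
    refine Finset.prod_pos fun j _ => ?_
    simp only [hu, hv]
    rw [← sub_div]
    exact div_pos (by linarith) hqK
  have hle : ∏ j, (v j - u j) ≤ 0 := by
    refine ge_of_tendsto' h fun N => ?_
    have := le_disc (fun n => digitalSeq d C n) N huv
    rw [natCard_lt_and_eq, Finset.filter_false_of_mem fun n _ => hempty n] at this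
    simpa [abs_of_pos hpos] using this
  exact absurd hpos hle.not_gt

theorem stmt19 (l : ℕ) (q : Fin l → ℕ) (hq : ∀ i, (q i).Prime)
    (hdist : Function.Injective q) (d : Fin l → ℕ) (hd : ∀ i, 1 ≤ d i)
    (C : (i : Fin l) → Fin (d i) → ℕ → ℕ → ZMod (q i)) :
    Filter.Tendsto
        (fun N => disc (fun n (p : Σ i : Fin l, Fin (d i)) =>
          digitalSeq (d p.1) (C p.1) n p.2) N) Filter.atTop (nhds 0) ↔
      ∀ i : Fin l, Filter.Tendsto
        (fun N => disc (fun n => digitalSeq (d i) (C i) n) N)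
        Filter.atTop (nhds 0) := by
  constructor
  · intro h i
    refine tendsto_of_tendsto_of_tendsto_of_le_of_le' tendsto_const_nhds
      (by simpa using h.const_mul 2) (Filter.Eventually.of_forall fun N => disc_nonneg _ N) ?_
    filter_upwards [Filter.eventually_gt_atTop 0] with N hN
    exact disc_comp_le (fun n (p : Σ i : Fin l, Fin (d i)) => digitalSeq (d p.1) (C p.1) n p.2)
      (e := Sigma.mk i) sigma_mk_injective hN
  · intro h
    have : ∀ i, NeZero (q i) := fun i => ⟨(hq i).ne_zero⟩
    refine tendsto_disc_of_cells (ι := Σ i : Fin l, Fin (d i)) (b := fun p => q p.1)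
      (fun p => (hq p.1).two_le) (fun n p k => digitSum (C p.1 p.2 k) n) fun K w => ?_
    refine tendsto_cell_of_tendsto_mean_char (b := fun p : Σ i : Fin l, Fin (d i) => q p.1)
      (fun n p k => digitSum (C p.1 p.2 k) n) (fun T hT => ?_) w
    obtain ⟨⟨i, j⟩, hp⟩ := Function.ne_iff.1 hT
    obtain ⟨m, hm⟩ := exists_row_combination_ne_zero (hq i) (h i)
      (t := fun j k => T ⟨i, j⟩ k) fun h0 => hp (congrFun h0 j)
    refine (tendsto_mean_digitChar hq hdist
      (fun i m => ∑ j, ∑ k : Fin K, T ⟨i, j⟩ k * C i j k m) ⟨i, m, hm⟩).congr fun N => ?_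
    congr 1
    refine Finset.sum_congr rfl fun n _ => ?_
    rw [Fintype.prod_sigma]
    refine Finset.prod_congr rfl fun i _ => ?_
    have e := sum_mul_digitSum (Finset.univ : Finset (Fin (d i) × Fin K))
      (fun x => T ⟨i, x.1⟩ x.2) (fun x => C i x.1 x.2) n
    simp only [Fintype.sum_prod_type] at e
    rw [digitChar, ← e, addChar_map_sum]
    exact Finset.prod_congr rfl fun j _ => addChar_map_sum _ _ _
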